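/- arXiv:1309.0195 — 3 statements merged into one kernel-verified Lean document; each statement's English description precedes it below -/
import Mathlib

section
/- (Proposition 1.) Let d ≥ 1, let 𝒫 be a finite set of interval paths each of length at least d + 1, and let integers a ≤ b be such that [a,b] is a region of 𝒫, i.e., every integer in [a,b] is an internal node of some path of 𝒫, and for every P ∈ 𝒫 whose set of internal nodes intersects [a,b], all internal nodes of P lie in [a,b]. Then for every finite set R ⊆ ℤ that d-satisfies every path of 𝒫, it holds that b − a + 1 ≤ (2d − 1) · |R ∩ [a,b]|. -/
/-- `v` is an internal node of the interval path `P(s,t)`. -/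
def IsInternal (s t v : ℤ) : Prop := s < v ∧ v < t

/-- The interval path `P(s,t)` is `d`-satisfied by the set `R` of regenerator
locations: among every `d` consecutive internal nodes of `P(s,t)` there is an
element of `R`. -/
def DSat (d s t : ℤ) (R : Set ℤ) : Prop :=
  ∀ x : ℤ, s + 1 ≤ x → x + d - 1 ≤ t - 1 → ∃ r ∈ R, x ≤ r ∧ r ≤ x + d - 1

/-- Proposition 1: if `[a,b]` is a region of the finite set `Ps` of paths
(each of length at least `d+1`), then any set `R` that `d`-satisfies every
path of `Ps` uses at least `(b - a + 1)/(2d - 1)` locations inside `[a,b]`. -/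
theorem stmt1 (d : ℤ) (hd : 1 ≤ d) (Ps : Finset (ℤ × ℤ))
    (hlen : ∀ P ∈ Ps, d + 1 ≤ P.2 - P.1)
    (a b : ℤ) (hab : a ≤ b)
    (hcover : ∀ x : ℤ, a ≤ x → x ≤ b → ∃ P ∈ Ps, IsInternal P.1 P.2 x)
    (hregion : ∀ P ∈ Ps, (∃ x : ℤ, IsInternal P.1 P.2 x ∧ a ≤ x ∧ x ≤ b) →
      ∀ y : ℤ, IsInternal P.1 P.2 y → a ≤ y ∧ y ≤ b)
    (R : Finset ℤ) (hR : ∀ P ∈ Ps, DSat d P.1 P.2 (R : Set ℤ)) :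
    b - a + 1 ≤ (2 * d - 1) * (((R.filter (fun r => a ≤ r ∧ r ≤ b)).card : ℤ)) := by
  have hsub : Finset.Icc a b ⊆ (R.filter (fun r => a ≤ r ∧ r ≤ b)).biUnion
      (fun r => Finset.Icc (r - d + 1) (r + d - 1)) := by
    intro x hx
    obtain ⟨hax, hxb⟩ := Finset.mem_Icc.mp hx
    obtain ⟨P, hP, hsx, hxt⟩ := hcover x hax hxb
    have hPlen := hlen P hP
    obtain ⟨r, hrR, hr₁, hr₂⟩ :=
      hR P hP (max (P.1 + 1) (x - d + 1)) (by omega) (by omega)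
    have hr := hregion P hP ⟨x, ⟨hsx, hxt⟩, hax, hxb⟩ r ⟨by omega, by omega⟩
    exact Finset.mem_biUnion.mpr ⟨r, Finset.mem_filter.mpr ⟨hrR, hr⟩,
      Finset.mem_Icc.mpr ⟨by omega, by omega⟩⟩
  have hcard := (Finset.card_le_card hsub).trans
    (Finset.card_biUnion_le_card_mul _ _ (2 * d - 1).toNat fun r _ => by
      rw [Int.card_Icc]; omega)
  rw [Int.card_Icc] at hcard
  zify at hcard
  rw [Int.toNat_of_nonneg (by omega), Int.toNat_of_nonneg (by omega)] at hcard
  linarith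
end

section
/- (Lemma: the deterministic online algorithm is 2-competitive on paths.) Let d ≥ 2, let 𝒫 be a finite set of interval paths each of length at least d + 1, and define R_alg := { x ∈ ℤ : d divides x and x is an internal node of some path of 𝒫 }. Then R_alg d-satisfies every path of 𝒫, and for every finite set R* ⊆ ℤ that d-satisfies every path of 𝒫, |R_alg| ≤ 2 · |R*|. -/
/-- A node of a path with at least `d` internal nodes is less than `d` away from a regenerator. -/
theorem DSat.exists_near {d s t m : ℤ} {R : Set ℤ} (hlen : d + 1 ≤ t - s)
    (h : DSat d s t R) (hm : IsInternal s t m) : ∃ r ∈ R, r < m + d ∧ m < r + d := by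
  obtain ⟨h₁, h₂⟩ := hm
  obtain ⟨r, hr, h₃, h₄⟩ := h (min m (t - d)) (by omega) (by omega)
  exact ⟨r, hr, by omega, by omega⟩

/-- A multiple of `d` less than `d` away from `r` is one of the two multiples around `r`. -/
theorem eq_mul_ediv_or_of_near {d m r : ℤ} (hdm : d ∣ m) (h₁ : r < m + d)
    (h₂ : m < r + d) : m = d * (r / d) ∨ m = d * (r / d + 1) := by
  obtain ⟨k, rfl⟩ := hdm
  have hd : 0 < d := by omega
  have hlt : r / d < k + 1 := Int.ediv_lt_of_lt_mul hd (by linarith)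
  have hle : k - 1 ≤ r / d := (Int.le_ediv_iff_mul_le hd).2 (by linarith)
  obtain h | h : k = r / d ∨ k = r / d + 1 := by omega
  · exact Or.inl (by rw [← h])
  · exact Or.inr (by rw [← h])

/-- The deterministic online algorithm placing regenerators at all internal
nodes divisible by `d` is feasible and 2-competitive on path topologies. -/
theorem stmt3 (d : ℤ) (hd : 2 ≤ d) (Ps : Finset (ℤ × ℤ))
    (hlen : ∀ P ∈ Ps, d + 1 ≤ P.2 - P.1) :
    (∀ P ∈ Ps, DSat d P.1 P.2 {x : ℤ | d ∣ x ∧ ∃ Q ∈ Ps, IsInternal Q.1 Q.2 x}) ∧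
    (∀ R : Finset ℤ, (∀ P ∈ Ps, DSat d P.1 P.2 (R : Set ℤ)) →
      {x : ℤ | d ∣ x ∧ ∃ Q ∈ Ps, IsInternal Q.1 Q.2 x}.ncard ≤ 2 * R.card) := by
  refine ⟨fun P hP x h₁ h₂ => ?_, fun R hR => ?_⟩
  · have hd₀ : 0 < d := by omega
    have hmod := Int.mul_ediv_add_emod (x + d - 1) d
    have hnonneg := Int.emod_nonneg (x + d - 1) hd₀.ne'
    have hlt := Int.emod_lt_of_pos (x + d - 1) hd₀
    exact ⟨d * ((x + d - 1) / d),
      ⟨dvd_mul_right _ _, P, hP, by linarith, by linarith⟩, by linarith, by linarith⟩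
  · have hsub : {x : ℤ | d ∣ x ∧ ∃ Q ∈ Ps, IsInternal Q.1 Q.2 x} ⊆
        ((R.image (fun r => d * (r / d)) ∪ R.image (fun r => d * (r / d + 1)) :
          Finset ℤ) : Set ℤ) := by
      rintro m ⟨hdm, Q, hQ, hm⟩
      obtain ⟨r, hr, h₁, h₂⟩ := (hR Q hQ).exists_near (hlen Q hQ) hm
      rw [Finset.mem_coe, Finset.mem_union, Finset.mem_image, Finset.mem_image]
      exact (eq_mul_ediv_or_of_near hdm h₁ h₂).imp
        (fun h => ⟨r, hr, h.symm⟩) (fun h => ⟨r, hr, h.symm⟩)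
    calc _ ≤ _ := Set.ncard_le_ncard hsub (Finset.finite_toSet _)
      _ = _ := Set.ncard_coe_finset _
      _ ≤ _ := Finset.card_union_le _ _
      _ ≤ R.card + R.card := add_le_add Finset.card_image_le Finset.card_image_le
      _ = 2 * R.card := (two_mul _).symm
end

section
/- (Construction underlying the deterministic lower bound of 2 on paths.) For every integer d ≥ 2 and every integer v with 1 ≤ v ≤ d (i.e., v is an internal node of the interval path P(0, d+1)), there exist integers w and r such that |w − v| = d + 1 (so the interval path with endpoints v and w has d + 1 edges and one endpoint at v) and the singleton {r} d-satisfies both P(0, d+1) and the interval path P(min(v,w), max(v,w)). -/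
/-- Construction for the deterministic lower bound of 2 on paths: for every
internal node `v` of `P(0, d+1)` there is a path of length `d+1` with one
endpoint at `v` such that a single location `d`-satisfies both paths. -/
theorem stmt6 (d : ℤ) (hd : 2 ≤ d) (v : ℤ) (hv : 1 ≤ v ∧ v ≤ d) :
    ∃ w r : ℤ, |w - v| = d + 1 ∧
      DSat d 0 (d + 1) {r} ∧ DSat d (min v w) (max v w) {r} := by
  obtain ⟨hv1, hvd⟩ := hv
  rcases hvd.lt_or_eq with h | rfl
  · refine ⟨v + d + 1, v + 1, ?_, ?_, ?_⟩
    · rw [abs_of_nonneg] <;> omega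
    · intro x hx hx'
      exact ⟨v + 1, rfl, by omega, by omega⟩
    · intro x hx hx'
      exact ⟨v + 1, rfl, by omega, by omega⟩
  · refine ⟨-1, 1, ?_, ?_, ?_⟩
    · rw [abs_of_nonpos] <;> omega
    · intro x hx hx'
      exact ⟨1, rfl, by omega, by omega⟩
    · intro x hx hx'
      exact ⟨1, rfl, by omega, by omega⟩
end
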